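/- On a forest G, a nonempty set S ⊆ V is the support of some feasible distribution if and only if the induced subgraph G[S] has maximum degree at most 1. -/

import Mathlib

open Finset

/-- `(Ax)_v` where `A` is the adjacency matrix plus the identity. -/
noncomputable def kkosMass {V : Type*} [Fintype V] [DecidableEq V]
    (G : SimpleGraph V) [DecidableRel G.Adj] (x : V → ℝ) (v : V) : ℝ :=
  ∑ u, if u = v ∨ G.Adj v u then x u else 0

/-- A finite forest in which some vertex has two distinct neighbors contains a pendant vertex `a`,
with only neighbor `c`, such that `c` has a further neighbor `d`. -/
theorem exists_pendant_path {V : Type*} [Finite V] {H : SimpleGraph V} (hH : H.IsAcyclic)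
    {u v w : V} (huv : H.Adj u v) (huw : H.Adj u w) (hvw : v ≠ w) :
    ∃ a c d, H.Adj a c ∧ H.Adj c d ∧ a ≠ d ∧ ∀ b, H.Adj a b → b = c := by
  have : Nonempty V := ⟨u⟩
  obtain ⟨a, b, p, hp, hmax⟩ := SimpleGraph.Walk.exists_isPath_forall_isPath_length_le_length H
  have hlen : 2 ≤ p.length := by
    have hq : (SimpleGraph.Walk.cons huv.symm (.cons huw .nil)).IsPath := by
      simp [SimpleGraph.Walk.cons_isPath_iff, huv.ne', huw.ne, hvw]
    simpa using hmax _ _ _ hq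
  have hleaf : ∀ e, H.Adj a e → e = p.snd := by
    intro e he
    by_cases hs : e ∈ p.support
    · exact hH.eq_snd_of_adj_start hp he hs
    · have := hmax _ _ _ (hp.cons (h := he.symm) hs)
      simp at this
  cases p with
  | nil => simp at hlen
  | cons hac q =>
    cases q with
    | nil => simp at hlen
    | cons hcd r =>
      refine ⟨_, _, _, hac, hcd, ?_, by simpa using hleaf⟩
      rintro rfl
      simp [SimpleGraph.Walk.cons_isPath_iff] at hp

/-- The support of a distribution whose masses agree along edges inside the support induces a
subgraph of maximum degree at most one, on a forest. -/
theorem eq_of_adj_of_kkosMass_eq {V : Type*} [Fintype V] [DecidableEq V]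
    {G : SimpleGraph V} [DecidableRel G.Adj] (hG : G.IsAcyclic) {x : V → ℝ}
    (hx : ∀ v, 0 ≤ x v)
    (hmass : ∀ u v : V, G.Adj u v → 0 < x u → 0 < x v → kkosMass G x u = kkosMass G x v)
    {u v w : V} (hu : 0 < x u) (hv : 0 < x v) (hw : 0 < x w)
    (huv : G.Adj u v) (huw : G.Adj u w) : v = w := by
  by_contra hvw
  let H : SimpleGraph V :=
    { Adj := fun a b => G.Adj a b ∧ 0 < x a ∧ 0 < x b
      symm := ⟨fun _ _ h => ⟨h.1.symm, h.2.2, h.2.1⟩⟩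
      loopless := ⟨fun a h => G.irrefl h.1⟩ }
  have hHG : H ≤ G := fun _ _ h => h.1
  obtain ⟨a, c, d, ⟨hac, ha, hc⟩, ⟨hcd, -, hd⟩, had, hleaf⟩ :=
    exists_pendant_path (hG.anti hHG) (H := H) (u := u) (v := v) (w := w)
      ⟨huv, hu, hv⟩ ⟨huw, hu, hw⟩ hvw
  have hleaf' : ∀ b, G.Adj a b → 0 < x b → b = c := fun b hb hxb => hleaf b ⟨hb, ha, hxb⟩
  refine (hmass a c hac ha hc).not_lt (Finset.sum_lt_sum (fun b _ => ?_) ⟨d, mem_univ d, ?_⟩)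
  · have hb := hx b
    by_cases h : b = c ∨ G.Adj c b
    · rw [if_pos h]
      split_ifs
      · exact le_rfl
      · exact hb
    · rw [if_neg h]
      split_ifs with h'
      · rcases h' with rfl | h'
        · exact absurd (Or.inr hac.symm) h
        · exact not_lt.1 fun hxb => h (Or.inl (hleaf' b h' hxb))
      · exact le_rfl
  · rw [if_pos (Or.inr hcd), if_neg]
    · exact hd
    · rintro (h | h)
      · exact had h.symm
      · exact hcd.ne' (hleaf' d h hd)

/-- On a forest `G`, a nonempty set `S ⊆ V` is the support of some feasible
distribution if and only if the induced subgraph `G[S]` has maximum degree at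
most 1 (no vertex of `S` has two distinct neighbors in `S`). -/
theorem stmt12 {V : Type*} [Fintype V] [DecidableEq V]
    (G : SimpleGraph V) [DecidableRel G.Adj] (hforest : G.IsAcyclic)
    (S : Set V) (hS : S.Nonempty) :
    (∃ x : V → ℝ, (∀ v, 0 ≤ x v) ∧ ∑ v, x v = 1 ∧
        (∀ v, 0 < x v ↔ v ∈ S) ∧
        (∀ u v : V, G.Adj u v → 0 < x u → 0 < x v →
          kkosMass G x u = kkosMass G x v)) ↔
      (∀ u ∈ S, ∀ v ∈ S, ∀ w ∈ S, G.Adj u v → G.Adj u w → v = w) := by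
  constructor
  · rintro ⟨x, hx, -, hsupp, hmass⟩ u hu v hv w hw huv huw
    exact eq_of_adj_of_kkosMass_eq hforest hx hmass ((hsupp u).2 hu) ((hsupp v).2 hv)
      ((hsupp w).2 hw) huv huw
  · intro hdeg
    classical
    have hcard : (0 : ℝ) < #S.toFinset := by
      exact_mod_cast Finset.card_pos.2 (Set.toFinset_nonempty.2 hS)
    have hinv : (0 : ℝ) < (#S.toFinset : ℝ)⁻¹ := inv_pos.2 hcard
    refine ⟨fun v => if v ∈ S then (#S.toFinset : ℝ)⁻¹ else 0, fun v => ?_, ?_, fun v => ?_, ?_⟩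
    · dsimp only
      split_ifs
      · exact hinv.le
      · exact le_rfl
    · simp_rw [← Set.mem_toFinset (s := S)]
      rw [Finset.sum_ite_mem, univ_inter, sum_const, nsmul_eq_mul, mul_inv_cancel₀ hcard.ne']
    · by_cases h : v ∈ S
      · simpa [h] using hinv
      · simp [h]
    · intro u v huv hu hv
      have huS : u ∈ S := by
        by_contra h
        simp [h] at hu
      have hvS : v ∈ S := by
        by_contra h
        simp [h] at hv
      refine Finset.sum_congr rfl fun b _ => ?_
      by_cases hb : b ∈ S
      · have hiff : (b = u ∨ G.Adj u b) ↔ (b = v ∨ G.Adj v b) := by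
          constructor
          · rintro (rfl | h)
            · exact Or.inr huv.symm
            · exact Or.inl (hdeg u huS b hb v hvS h huv)
          · rintro (rfl | h)
            · exact Or.inr huv
            · exact Or.inl (hdeg v hvS b hb u huS h huv.symm)
        simp only [hiff]
      · simp [hb]
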